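/- arXiv:2502.02177 — 12 statements merged into one kernel-verified Lean document; each statement's English description precedes it below -/
import Mathlib

section
/- Total natural gradient of the KL-divergence: let t ↦ q(t) and t ↦ r(t) be curves of positive probability functions on a finite nonempty set Ω, with q(t)(x) and r(t)(x) differentiable in t for every x. Then for every t, (d/dt) KL(q(t)‖r(t)) = −⟨q̇(t), s_{q(t)}(r(t))⟩_{q(t)} − ⟨η_{r(t)}(q(t)), ṙ(t)⟩_{r(t)}. -/
/-- The coordinate derivatives of a curve with constant total mass sum to zero. -/
theorem sum_deriv_eq_zero_of_sum_eq_const {Ω : Type*} [Fintype Ω] {p : ℝ → Ω → ℝ} {c : ℝ}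
    (hsum : ∀ t, ∑ x, p t x = c) (hd : ∀ x, Differentiable ℝ fun t => p t x) (t : ℝ) :
    ∑ x, deriv (fun s => p s x) t = 0 := by
  rw [← deriv_fun_sum fun x _ => (hd x) t]
  simp [hsum]

/-- Derivative of a single term of the Kullback–Leibler divergence. -/
theorem HasDerivAt.log_div_mul {f g : ℝ → ℝ} {f' g' t : ℝ} (hf : HasDerivAt f f' t)
    (hg : HasDerivAt g g' t) (hft : f t ≠ 0) (hgt : g t ≠ 0) :
    HasDerivAt (fun s => Real.log (f s / g s) * f s)
      (f' - f t / g t * g' + Real.log (f t / g t) * f') t := by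
  refine (((hf.fun_div hg hgt).log (div_ne_zero hft hgt)).mul hf).congr_deriv ?_
  field_simp


/-- Total natural gradient of the KL-divergence.
For curves `t ↦ q t` and `t ↦ r t` of positive probability functions on a
finite nonempty set `Ω`, with each coordinate differentiable in `t`,
`(d/dt) KL(q(t)‖r(t)) = −⟨q̇(t), s_{q(t)}(r(t))⟩_{q(t)} − ⟨η_{r(t)}(q(t)), ṙ(t)⟩_{r(t)}`,
where `q̇(t)(x) = (d/dt) log q(t)(x)`, `s_q(r) = log(r/q) − E_q[log(r/q)]`,
`η_r(q) = q/r − 1`, `E_p[v] = ∑ x, v x * p x` and `⟨v,w⟩_p = E_p[v·w]`. -/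
theorem kl_total_natural_gradient
    {Ω : Type*} [Fintype Ω] [Nonempty Ω]
    (q r : ℝ → Ω → ℝ)
    (hqpos : ∀ t x, 0 < q t x) (hqsum : ∀ t, ∑ x, q t x = 1)
    (hrpos : ∀ t x, 0 < r t x) (hrsum : ∀ t, ∑ x, r t x = 1)
    (hqd : ∀ x, Differentiable ℝ fun t => q t x)
    (hrd : ∀ x, Differentiable ℝ fun t => r t x)
    (t : ℝ) :
    HasDerivAt (fun s => ∑ x, Real.log (q s x / r s x) * q s x)
      (-(∑ x, deriv (fun s => Real.log (q s x)) t *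
            (Real.log (r t x / q t x) - ∑ y, Real.log (r t y / q t y) * q t y) * q t x)
        - ∑ x, (q t x / r t x - 1) * deriv (fun s => Real.log (r s x)) t * r t x) t := by
  have hq x := ((hqd x) t).hasDerivAt
  have hr x := ((hrd x) t).hasDerivAt
  have hq_sum := sum_deriv_eq_zero_of_sum_eq_const hqsum hqd t
  have hr_sum := sum_deriv_eq_zero_of_sum_eq_const hrsum hrd t
  refine (HasDerivAt.fun_sum fun x _ =>
    (hq x).log_div_mul (hr x) (hqpos t x).ne' (hrpos t x).ne').congr_deriv ?_
  generalize ∑ y, Real.log (r t y / q t y) * q t y = C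
  have key : ∀ x, deriv (fun s => q s x) t - q t x / r t x * deriv (fun s => r s x) t
        + Real.log (q t x / r t x) * deriv (fun s => q s x) t
      = -(deriv (fun s => Real.log (q s x)) t * (Real.log (r t x / q t x) - C) * q t x)
        - (q t x / r t x - 1) * deriv (fun s => Real.log (r s x)) t * r t x
        + ((1 - C) * deriv (fun s => q s x) t - deriv (fun s => r s x) t) := by
    intro x
    have hq0 := (hqpos t x).ne'
    have hr0 := (hrpos t x).ne'
    rw [((hq x).log hq0).deriv, ((hr x).log hr0).deriv, Real.log_div hq0 hr0,
      Real.log_div hr0 hq0]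
    field_simp
    ring
  rw [Finset.sum_congr rfl fun x _ => key x]
  simp only [Finset.sum_add_distrib, Finset.sum_sub_distrib, Finset.sum_neg_distrib,
    ← Finset.mul_sum, hq_sum, hr_sum, mul_zero, sub_zero, add_zero]
end

section
/- Solution of the exponential gradient flow: let r and q₀ be positive probability functions on a finite nonempty set Ω, let v₀ = s_r(q₀), and let K_r(v) = log E_r[e^v]. Then the curve q(t) = exp(e^{−t} v₀ − K_r(e^{−t} v₀)) · r consists of positive probability functions for all t ∈ ℝ, satisfies q(0) = q₀, and solves the gradient flow equation q̇(t) = s_{q(t)}(r), where q̇(t)(x) = (d/dt) log q(t)(x). -/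
/-- The derivative of `t ↦ log E_r[exp (e^{-t} v)]`: the cumulant function along `e^{-t} v`. -/
theorem hasDerivAt_log_sum_exp_exp_neg {Ω : Type*} [Fintype Ω] (r v : Ω → ℝ) (t : ℝ)
    (hZ : ∑ x, Real.exp (Real.exp (-t) * v x) * r x ≠ 0) :
    HasDerivAt (fun s => Real.log (∑ x, Real.exp (Real.exp (-s) * v x) * r x))
      (-Real.exp (-t) * (∑ x, v x * (Real.exp (Real.exp (-t) * v x) * r x)) /
        ∑ x, Real.exp (Real.exp (-t) * v x) * r x) t := by
  refine HasDerivAt.log ?_ hZ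
  rw [Finset.mul_sum]
  refine HasDerivAt.fun_sum fun x _ => ?_
  refine (hasDerivAt_neg t).exp.mul_const (v x) |>.exp.mul_const (r x) |>.congr_deriv ?_
  ring

/-- Solution of the exponential gradient flow.
Let `r`, `q₀` be positive probability functions on a finite nonempty `Ω`,
`v₀ = s_r(q₀) = log(q₀/r) − E_r[log(q₀/r)]`, and `K_r(v) = log E_r[e^v]`.
Then `q t = exp(e^{−t} v₀ − K_r(e^{−t} v₀)) · r` consists of positive
probability functions, satisfies `q 0 = q₀`, and solves
`q̇(t) = s_{q(t)}(r)`, where `q̇(t)(x) = (d/dt) log q(t)(x)`. -/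
theorem exponential_gradient_flow_solution
    {Ω : Type*} [Fintype Ω] [Nonempty Ω]
    (r q₀ : Ω → ℝ)
    (hrpos : ∀ x, 0 < r x) (hrsum : ∑ x, r x = 1)
    (hq₀pos : ∀ x, 0 < q₀ x) (hq₀sum : ∑ x, q₀ x = 1)
    (v₀ : Ω → ℝ)
    (hv₀ : v₀ = fun x => Real.log (q₀ x / r x) - ∑ y, Real.log (q₀ y / r y) * r y)
    (K : (Ω → ℝ) → ℝ)
    (hK : K = fun v => Real.log (∑ x, Real.exp (v x) * r x))
    (q : ℝ → Ω → ℝ)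
    (hq : q = fun t x =>
      Real.exp (Real.exp (-t) * v₀ x - K (fun y => Real.exp (-t) * v₀ y)) * r x) :
    (∀ t x, 0 < q t x) ∧ (∀ t, ∑ x, q t x = 1) ∧ (q 0 = q₀) ∧
      (∀ t x, HasDerivAt (fun s => Real.log (q s x))
        (Real.log (r x / q t x) - ∑ y, Real.log (r y / q t y) * q t y) t) := by
  have hZpos : ∀ v : Ω → ℝ, 0 < ∑ x, Real.exp (v x) * r x := fun v =>
    Finset.sum_pos (fun x _ => mul_pos (Real.exp_pos _) (hrpos x)) Finset.univ_nonempty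
  have hqZ : ∀ t x, q t x = Real.exp (Real.exp (-t) * v₀ x) * r x /
      ∑ y, Real.exp (Real.exp (-t) * v₀ y) * r y := by
    intro t x
    simp only [hq, hK]
    rw [Real.exp_sub, Real.exp_log (hZpos _)]
    ring
  have hqpos : ∀ t x, 0 < q t x := fun t x => by
    rw [hqZ]
    exact div_pos (mul_pos (Real.exp_pos _) (hrpos x)) (hZpos _)
  have hqsum : ∀ t, ∑ x, q t x = 1 := fun t => by
    simp only [hqZ]
    rw [← Finset.sum_div, div_self (hZpos _).ne']
  refine ⟨hqpos, hqsum, ?_, fun t x => ?_⟩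
  · have hexp : ∀ x, Real.exp (v₀ x) * r x =
        q₀ x / Real.exp (∑ y, Real.log (q₀ y / r y) * r y) := by
      intro x
      have hr := (hrpos x).ne'
      simp only [hv₀]
      rw [Real.exp_sub, Real.exp_log (div_pos (hq₀pos x) (hrpos x))]
      field_simp
    funext x
    rw [hqZ]
    simp only [neg_zero, Real.exp_zero, one_mul, hexp]
    rw [← Finset.sum_div, hq₀sum]
    field_simp
  · have hlog : ∀ s y, Real.log (q s y) =
        Real.exp (-s) * v₀ y - K (fun z => Real.exp (-s) * v₀ z) + Real.log (r y) := by
      intro s y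
      rw [hq, Real.log_mul (Real.exp_ne_zero _) (hrpos y).ne', Real.log_exp]
    have hscore : ∀ y, Real.log (r y / q t y) =
        K (fun z => Real.exp (-t) * v₀ z) - Real.exp (-t) * v₀ y := by
      intro y
      rw [Real.log_div (hrpos y).ne' (hqpos t y).ne', hlog]
      ring
    have hmean : ∑ y, v₀ y * q t y =
        (∑ y, v₀ y * (Real.exp (Real.exp (-t) * v₀ y) * r y)) /
          ∑ y, Real.exp (Real.exp (-t) * v₀ y) * r y := by
      simp only [hqZ, Finset.sum_div, mul_div_assoc]
    have hderivK : HasDerivAt (fun s => K (fun z => Real.exp (-s) * v₀ z))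
        (-Real.exp (-t) * ∑ y, v₀ y * q t y) t := by
      rw [hmean, ← mul_div_assoc, hK]
      exact hasDerivAt_log_sum_exp_exp_neg r v₀ t (hZpos _).ne'
    simp only [hlog]
    refine (hasDerivAt_neg t).exp.mul_const (v₀ x) |>.sub hderivK
      |>.add_const (Real.log (r x)) |>.congr_deriv ?_
    simp only [hscore, sub_mul, Finset.sum_sub_distrib, ← Finset.mul_sum, hqsum, mul_assoc]
    ring
end

section
/- Solution of the mixture gradient flow: let q and r₀ be positive probability functions on a finite nonempty set Ω. Then the curve r(t) = e^{−t} r₀ + (1 − e^{−t}) q, for t ≥ 0, consists of positive probability functions, satisfies r(0) = r₀, and solves the gradient flow equation ṙ(t) = η_{r(t)}(q), where ṙ(t)(x) = (d/dt) log r(t)(x) and η_r(q) = q/r − 1. -/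
/-- Solution of the mixture gradient flow.
Let `q`, `r₀` be positive probability functions on a finite nonempty `Ω`.
Then `r t = e^{−t} r₀ + (1 − e^{−t}) q`, for `t ≥ 0`, consists of positive
probability functions, satisfies `r 0 = r₀`, and solves the gradient flow
equation `ṙ(t) = η_{r(t)}(q) = q/r(t) − 1`, where
`ṙ(t)(x) = (d/dt) log r(t)(x)`. -/
theorem mixture_gradient_flow_solution
    {Ω : Type*} [Fintype Ω] [Nonempty Ω]
    (q r₀ : Ω → ℝ)
    (hqpos : ∀ x, 0 < q x) (hqsum : ∑ x, q x = 1)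
    (hr₀pos : ∀ x, 0 < r₀ x) (hr₀sum : ∑ x, r₀ x = 1)
    (r : ℝ → Ω → ℝ)
    (hr : r = fun t x => Real.exp (-t) * r₀ x + (1 - Real.exp (-t)) * q x) :
    (∀ t, 0 ≤ t → ∀ x, 0 < r t x) ∧ (∀ t, 0 ≤ t → ∑ x, r t x = 1) ∧ (r 0 = r₀) ∧
      (∀ t, 0 ≤ t → ∀ x, HasDerivAt (fun s => Real.log (r s x))
        (q x / r t x - 1) t) := by
  subst hr
  have hpos : ∀ t, 0 ≤ t → ∀ x, 0 < Real.exp (-t) * r₀ x + (1 - Real.exp (-t)) * q x := by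
    intro t ht x
    have hle : Real.exp (-t) ≤ 1 := Real.exp_le_one_iff.mpr (neg_nonpos.mpr ht)
    exact add_pos_of_pos_of_nonneg (mul_pos (Real.exp_pos _) (hr₀pos x))
      (mul_nonneg (sub_nonneg.mpr hle) (hqpos x).le)
  refine ⟨hpos, fun t _ => ?_, ?_, fun t ht x => ?_⟩
  · simp [Finset.sum_add_distrib, ← Finset.mul_sum, hqsum, hr₀sum]
  · ext x
    simp
  · have hexp : HasDerivAt (fun s : ℝ => Real.exp (-s)) (-Real.exp (-t)) t := by
      simpa using (hasDerivAt_neg t).exp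
    have hcurve := (hexp.mul_const (r₀ x)).fun_add ((hexp.const_sub 1).mul_const (q x))
    have hne := (hpos t ht x).ne'
    convert hcurve.log hne using 1
    rw [div_sub_one hne]
    ring
end

section
/- Total natural gradient of the cross entropy: let t ↦ q(t) and t ↦ r(t) be curves of positive probability functions on a finite nonempty set Ω, with q(t)(x) and r(t)(x) differentiable in t for every x. Then for every t, (d/dt) H(q(t), r(t)) = ⟨q̇(t), −log r(t) − H(q(t), r(t))⟩_{q(t)} − ⟨η_{r(t)}(q(t)), ṙ(t)⟩_{r(t)}, where H(q,r) = E_q[−log r] is the cross entropy. -/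
/-- Total natural gradient of the cross entropy.
For curves `t ↦ q t`, `t ↦ r t` of positive probability functions on a finite
nonempty `Ω`, with coordinates differentiable in `t`,
`(d/dt) H(q(t), r(t)) = ⟨q̇(t), −log r(t) − H(q(t),r(t))⟩_{q(t)}
  − ⟨η_{r(t)}(q(t)), ṙ(t)⟩_{r(t)}`,
where `H(q,r) = E_q[−log r]`, `η_r(q) = q/r − 1`, and
`q̇(t)(x) = (d/dt) log q(t)(x)`. -/
theorem cross_entropy_total_natural_gradient
    {Ω : Type*} [Fintype Ω] [Nonempty Ω]
    (q r : ℝ → Ω → ℝ)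
    (hqpos : ∀ t x, 0 < q t x) (hqsum : ∀ t, ∑ x, q t x = 1)
    (hrpos : ∀ t x, 0 < r t x) (hrsum : ∀ t, ∑ x, r t x = 1)
    (hqd : ∀ x, Differentiable ℝ fun t => q t x)
    (hrd : ∀ x, Differentiable ℝ fun t => r t x)
    (t : ℝ) :
    HasDerivAt (fun s => ∑ x, -Real.log (r s x) * q s x)
      ((∑ x, deriv (fun s => Real.log (q s x)) t *
          (-Real.log (r t x) - ∑ y, -Real.log (r t y) * q t y) * q t x)
        - ∑ x, (q t x / r t x - 1) * deriv (fun s => Real.log (r s x)) t * r t x) t := by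
  have hlog {p : ℝ → Ω → ℝ} (hpos : ∀ t x, 0 < p t x)
      (hd : ∀ x, Differentiable ℝ fun t => p t x) (x : Ω) :
      HasDerivAt (fun s => Real.log (p s x)) (deriv (fun s => p s x) t / p t x) t :=
    (hd x t).hasDerivAt.log (hpos t x).ne'
  have hq := sum_deriv_eq_zero_of_sum_eq_const hqsum hqd t
  have hr := sum_deriv_eq_zero_of_sum_eq_const hrsum hrd t
  have key : HasDerivAt (fun s => ∑ x, -Real.log (r s x) * q s x)
      (∑ x, (-(deriv (fun s => r s x) t / r t x) * q t x
        + -Real.log (r t x) * deriv (fun s => q s x) t)) t :=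
    HasDerivAt.fun_sum fun x _ => (hlog hrpos hrd x).fun_neg.fun_mul (hqd x t).hasDerivAt
  convert key using 1
  simp only [(hlog hqpos hqd _).deriv, (hlog hrpos hrd _).deriv]
  generalize ∑ y, -Real.log (r t y) * q t y = H
  have e : ∀ x, deriv (fun s => q s x) t / q t x * (-Real.log (r t x) - H) * q t x
      - (q t x / r t x - 1) * (deriv (fun s => r s x) t / r t x) * r t x
      = (-(deriv (fun s => r s x) t / r t x) * q t x
        + -Real.log (r t x) * deriv (fun s => q s x) t)
        - H * deriv (fun s => q s x) t + deriv (fun s => r s x) t := by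
    intro x
    have h₁ := (hqpos t x).ne'
    have h₂ := (hrpos t x).ne'
    field_simp
    ring
  rw [← Finset.sum_sub_distrib, Finset.sum_congr rfl fun x _ => e x, Finset.sum_add_distrib,
    Finset.sum_sub_distrib, ← Finset.mul_sum, hq, hr, mul_zero, sub_zero, add_zero]
end

section
/- The Jensen–Shannon divergence is the minimum of the mean KL-divergence to a common reference: let q and r be positive probability functions on a finite nonempty set Ω and let m = (q+r)/2. Then for every positive probability function p on Ω, (1/2)(KL(q‖p) + KL(r‖p)) ≥ (1/2)(KL(q‖m) + KL(r‖m)) = JS(q,r), with equality if and only if p = m. -/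
/-- The integrand of the Kullback–Leibler divergence dominates `a - b`. -/
theorem sub_le_log_div_mul {a b : ℝ} (ha : 0 < a) (hb : 0 < b) :
    a - b ≤ Real.log (a / b) * a := by
  have h := mul_le_mul_of_nonneg_right (Real.one_sub_inv_le_log_of_pos (div_pos ha hb)) ha.le
  rwa [inv_div, sub_mul, one_mul, div_mul_cancel₀ b ha.ne'] at h

theorem eq_of_log_div_mul_eq_sub {a b : ℝ} (ha : 0 < a) (hb : 0 < b)
    (h : a - b = Real.log (a / b) * a) : a = b := by
  by_contra hne
  have hba : b / a ≠ 1 := fun h1 => hne ((div_eq_one_iff_eq ha.ne').1 h1).symm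
  have hlt := mul_lt_mul_of_pos_right (Real.log_lt_sub_one_of_pos (div_pos hb ha) hba) ha
  rw [sub_mul, one_mul, div_mul_cancel₀ b ha.ne', ← inv_div, Real.log_inv] at hlt
  linarith

/-- Gibbs' inequality. -/
theorem sum_log_div_mul_nonneg {Ω : Type*} [Fintype Ω] {a b : Ω → ℝ}
    (ha : ∀ x, 0 < a x) (hb : ∀ x, 0 < b x) (hab : ∑ x, a x = ∑ x, b x) :
    0 ≤ ∑ x, Real.log (a x / b x) * a x := by
  have h := Finset.sum_le_sum fun x (_ : x ∈ Finset.univ) => sub_le_log_div_mul (ha x) (hb x)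
  rwa [Finset.sum_sub_distrib, hab, sub_self] at h

/-- The equality case of Gibbs' inequality. -/
theorem sum_log_div_mul_eq_zero_iff {Ω : Type*} [Fintype Ω] {a b : Ω → ℝ}
    (ha : ∀ x, 0 < a x) (hb : ∀ x, 0 < b x) (hab : ∑ x, a x = ∑ x, b x) :
    ∑ x, Real.log (a x / b x) * a x = 0 ↔ a = b := by
  constructor
  · intro h
    have hs : ∑ x, (a x - b x) = ∑ x, Real.log (a x / b x) * a x := by
      rw [Finset.sum_sub_distrib, hab, sub_self, h]
    have hx := (Finset.sum_eq_sum_iff_of_le fun x _ => sub_le_log_div_mul (ha x) (hb x)).1 hs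
    exact funext fun x => eq_of_log_div_mul_eq_sub (ha x) (hb x) (hx x (Finset.mem_univ x))
  · rintro rfl
    exact Finset.sum_eq_zero fun x _ => by rw [div_self (ha x).ne', Real.log_one, zero_mul]

/-- The compensation identity: the mean divergence from `p` exceeds the mean divergence from the
midpoint of `q` and `r` by the divergence of the midpoint from `p`. -/
theorem mean_sum_log_div_mul_eq_add {Ω : Type*} [Fintype Ω] {q r m p : Ω → ℝ}
    (hq : ∀ x, 0 < q x) (hr : ∀ x, 0 < r x) (hm : ∀ x, m x = (q x + r x) / 2)
    (hp : ∀ x, 0 < p x) :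
    (1 / 2) * ((∑ x, Real.log (q x / p x) * q x) + ∑ x, Real.log (r x / p x) * r x)
      = (1 / 2) * ((∑ x, Real.log (q x / m x) * q x) + ∑ x, Real.log (r x / m x) * r x)
        + ∑ x, Real.log (m x / p x) * m x := by
  simp only [← Finset.sum_add_distrib, Finset.mul_sum]
  refine Finset.sum_congr rfl fun x _ => ?_
  have hmx : 0 < m x := by linarith [hm x, hq x, hr x]
  rw [Real.log_div (hq x).ne' (hp x).ne', Real.log_div (hr x).ne' (hp x).ne',
    Real.log_div (hq x).ne' hmx.ne', Real.log_div (hr x).ne' hmx.ne',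
    Real.log_div hmx.ne' (hp x).ne']
  linear_combination (Real.log (p x) - Real.log (m x)) * hm x

/-- The Jensen–Shannon divergence is the minimum of the mean
KL-divergence to a common reference. With `m = (q+r)/2` and
`KL(q‖p) = E_q[log(q/p)]`, for every positive probability function `p`,
`(1/2)(KL(q‖p) + KL(r‖p)) ≥ (1/2)(KL(q‖m) + KL(r‖m)) = JS(q,r)`,
with equality iff `p = m`. -/
theorem jensen_shannon_is_min_mean_kl
    {Ω : Type*} [Fintype Ω] [Nonempty Ω]
    (q r : Ω → ℝ)
    (hqpos : ∀ x, 0 < q x) (hqsum : ∑ x, q x = 1)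
    (hrpos : ∀ x, 0 < r x) (hrsum : ∑ x, r x = 1)
    (m : Ω → ℝ) (hm : m = fun x => (q x + r x) / 2) :
    ∀ p : Ω → ℝ, (∀ x, 0 < p x) → (∑ x, p x = 1) →
      ((1 / 2) * ((∑ x, Real.log (q x / m x) * q x) + ∑ x, Real.log (r x / m x) * r x)
        ≤ (1 / 2) * ((∑ x, Real.log (q x / p x) * q x) + ∑ x, Real.log (r x / p x) * r x)
      ∧ ((1 / 2) * ((∑ x, Real.log (q x / p x) * q x) + ∑ x, Real.log (r x / p x) * r x)
          = (1 / 2) * ((∑ x, Real.log (q x / m x) * q x) + ∑ x, Real.log (r x / m x) * r x)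
         ↔ p = m)) := by
  intro p hp hpsum
  have hmx : ∀ x, m x = (q x + r x) / 2 := fun x => congrFun hm x
  have hmpos : ∀ x, 0 < m x := fun x => by linarith [hmx x, hqpos x, hrpos x]
  have hsum : ∑ x, m x = ∑ x, p x := by
    simp only [hmx]
    rw [← Finset.sum_div, Finset.sum_add_distrib, hqsum, hrsum, hpsum]
    norm_num
  rw [mean_sum_log_div_mul_eq_add hqpos hrpos hmx hp]
  refine ⟨le_add_of_nonneg_right (sum_log_div_mul_nonneg hmpos hp hsum), ?_⟩
  rw [add_eq_left, sum_log_div_mul_eq_zero_iff hmpos hp hsum, eq_comm]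
end

section
/- Natural gradient of the Jensen–Shannon divergence in the first argument: let r be a positive probability function on a finite nonempty set Ω and let t ↦ q(t) be a curve of positive probability functions on Ω with q(t)(x) differentiable in t for every x. Then for every t, (d/dt) JS(q(t), r) = ⟨q̇(t), −(1/2) s_{q(t)}((q(t)+r)/2)⟩_{q(t)}. -/
/-- Derivative of one summand of the Jensen–Shannon divergence in its first argument. -/
theorem hasDerivAt_jensen_shannon_summand {f : ℝ → ℝ} {f' c t : ℝ} (hf : HasDerivAt f f' t)
    (hpos : ∀ s, 0 < f s) (hc : 0 < c) :
    HasDerivAt (fun s => (1 / 2) * (Real.log (f s / ((f s + c) / 2)) * f s)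
        + (1 / 2) * (Real.log (c / ((f s + c) / 2)) * c))
      (-(1 / 2) * Real.log (((f t + c) / 2) / f t) * f') t := by
  have hft := hpos t
  have hm : ∀ s, 0 < (f s + c) / 2 := fun s => by linarith [hpos s]
  have hmid : HasDerivAt (fun s => (f s + c) / 2) (f' / 2) t := (hf.add_const c).div_const 2
  have hlogf := hf.log hft.ne'
  have hlogm := hmid.log (hm t).ne'
  have h := (((hlogf.sub hlogm).mul hf).const_mul (1 / 2)).add
    (((hlogm.const_sub (Real.log c)).mul_const c).const_mul (1 / 2))
  refine (h.congr_deriv ?_).congr_of_eventuallyEq (Filter.Eventually.of_forall fun s => ?_)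
  · rw [Real.log_div (hm t).ne' hft.ne']
    have hfc : f t + c ≠ 0 := by linarith
    simp only [Pi.sub_apply]
    field_simp
    ring
  · simp only [Pi.add_apply, Pi.mul_apply, Pi.sub_apply]
    rw [Real.log_div (hpos s).ne' (hm s).ne', Real.log_div hc.ne' (hm s).ne']

/-- Natural gradient of the Jensen–Shannon divergence in the
first argument. With `JS(q,r) = (1/2) KL(q‖(q+r)/2) + (1/2) KL(r‖(q+r)/2)`
and `s_q(m) = log(m/q) − E_q[log(m/q)]`, for a curve `t ↦ q t` of positive
probability functions and a fixed positive probability function `r`,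
`(d/dt) JS(q(t), r) = ⟨q̇(t), −(1/2) s_{q(t)}((q(t)+r)/2)⟩_{q(t)}`. -/
theorem jensen_shannon_natural_gradient_first
    {Ω : Type*} [Fintype Ω] [Nonempty Ω]
    (r : Ω → ℝ) (hrpos : ∀ x, 0 < r x) (hrsum : ∑ x, r x = 1)
    (q : ℝ → Ω → ℝ)
    (hqpos : ∀ t x, 0 < q t x) (hqsum : ∀ t, ∑ x, q t x = 1)
    (hqd : ∀ x, Differentiable ℝ fun t => q t x)
    (t : ℝ) :
    HasDerivAt (fun s =>
        (1 / 2) * ∑ x, Real.log (q s x / ((q s x + r x) / 2)) * q s x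
          + (1 / 2) * ∑ x, Real.log (r x / ((q s x + r x) / 2)) * r x)
      (∑ x, deriv (fun s => Real.log (q s x)) t *
          (-(1 / 2) * (Real.log (((q t x + r x) / 2) / q t x)
            - ∑ y, Real.log (((q t y + r y) / 2) / q t y) * q t y)) * q t x) t := by
  have hd : ∀ x, HasDerivAt (fun s => q s x) (deriv (fun s => q s x) t) t :=
    fun x => (hqd x t).hasDerivAt
  have hzero : ∑ x, deriv (fun s => q s x) t = 0 := by
    have h := HasDerivAt.fun_sum (u := Finset.univ) fun x _ => hd x
    simp only [hqsum] at h
    exact h.unique (hasDerivAt_const t 1)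
  have hsum := HasDerivAt.fun_sum (u := Finset.univ) fun x _ =>
    hasDerivAt_jensen_shannon_summand (hd x) (fun s => hqpos s x) (hrpos x)
  simp only [Finset.sum_add_distrib, ← Finset.mul_sum] at hsum
  refine hsum.congr_deriv ?_
  generalize ∑ y, Real.log (((q t y + r y) / 2) / q t y) * q t y = E
  have hterm : ∀ x, deriv (fun s => Real.log (q s x)) t *
      (-(1 / 2) * (Real.log (((q t x + r x) / 2) / q t x) - E)) * q t x
      = -(1 / 2) * Real.log (((q t x + r x) / 2) / q t x) * deriv (fun s => q s x) t
        + (1 / 2) * E * deriv (fun s => q s x) t := fun x => by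
    have hx := (hqpos t x).ne'
    rw [((hd x).log hx).deriv]
    generalize Real.log (((q t x + r x) / 2) / q t x) = L
    field_simp
    ring
  rw [Finset.sum_congr rfl fun x _ => hterm x, Finset.sum_add_distrib, ← Finset.mul_sum, hzero,
    mul_zero, add_zero]
end

section
/- Derivative of the joint marginalization (mean-field approximation): let Ω = Ω₁ × Ω₂ with Ω₁, Ω₂ finite nonempty, and let t ↦ r(t) be a curve of positive probability functions on Ω with r(t)(x,y) differentiable in t for every (x,y). Then the curve of product approximations t ↦ r₁(t) ⊗ r₂(t), (r₁(t) ⊗ r₂(t))(x,y) = r₁(t)(x) · r₂(t)(y), consists of positive probability functions on Ω, and its velocity is the sum of the conditional expectations of the velocity of r: for every t and every (x,y), (d/dt) log (r₁(t)(x) r₂(t)(y)) = E_{r(t)}[ṙ(t) | Π₁ = x] + E_{r(t)}[ṙ(t) | Π₂ = y]. -/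
/-- The logarithmic derivative of a finite sum of positive functions is the weighted mean of the
logarithmic derivatives of the summands. -/
theorem hasDerivAt_log_sum {ι : Type*} [Fintype ι] [Nonempty ι] {f : ℝ → ι → ℝ} {t : ℝ}
    (hpos : ∀ i, 0 < f t i) (hd : ∀ i, DifferentiableAt ℝ (fun s => f s i) t) :
    HasDerivAt (fun s => Real.log (∑ i, f s i))
      (∑ i, deriv (fun s => Real.log (f s i)) t * f t i / ∑ j, f t j) t := by
  have hsum : 0 < ∑ i, f t i := Finset.sum_pos (fun i _ => hpos i) Finset.univ_nonempty
  have h : HasDerivAt (fun s => ∑ i, f s i) (∑ i, deriv (fun s => f s i) t) t :=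
    HasDerivAt.fun_sum fun i _ => (hd i).hasDerivAt
  convert h.log hsum.ne' using 1
  rw [Finset.sum_div]
  refine Finset.sum_congr rfl fun i _ => ?_
  rw [((hd i).hasDerivAt.log (hpos i).ne').deriv, div_mul_cancel₀ _ (hpos i).ne']

/-- Derivative of the joint marginalization (mean-field
approximation). For a curve `t ↦ r t` of positive probability functions on
`Ω₁ × Ω₂` with margins `r₁`, `r₂`, the curve of product approximations
`(x,y) ↦ r₁(t)(x) · r₂(t)(y)` consists of positive probability functions on
`Ω₁ × Ω₂`, and its velocity is the sum of the conditional expectations of the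
velocity of `r`:
`(d/dt) log (r₁(t)(x) r₂(t)(y)) = E_{r(t)}[ṙ(t) | Π₁ = x] + E_{r(t)}[ṙ(t) | Π₂ = y]`. -/
theorem joint_marginalization_derivative
    {Ω₁ Ω₂ : Type*} [Fintype Ω₁] [Nonempty Ω₁] [Fintype Ω₂] [Nonempty Ω₂]
    (r : ℝ → Ω₁ × Ω₂ → ℝ)
    (hrpos : ∀ t z, 0 < r t z) (hrsum : ∀ t, ∑ z, r t z = 1)
    (hrd : ∀ z, Differentiable ℝ fun t => r t z)
    (r₁ : ℝ → Ω₁ → ℝ) (hr₁ : r₁ = fun t x => ∑ y, r t (x, y))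
    (r₂ : ℝ → Ω₂ → ℝ) (hr₂ : r₂ = fun t y => ∑ x, r t (x, y)) :
    (∀ t (z : Ω₁ × Ω₂), 0 < r₁ t z.1 * r₂ t z.2) ∧
      (∀ t, ∑ z : Ω₁ × Ω₂, r₁ t z.1 * r₂ t z.2 = 1) ∧
      (∀ t x y, HasDerivAt (fun s => Real.log (r₁ s x * r₂ s y))
        ((∑ y', deriv (fun s => Real.log (r s (x, y'))) t * r t (x, y') / r₁ t x)
          + ∑ x', deriv (fun s => Real.log (r s (x', y))) t * r t (x', y) / r₂ t y) t) := by
  subst hr₁ hr₂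
  have h₁ : ∀ t x, 0 < ∑ y, r t (x, y) := fun t x =>
    Finset.sum_pos (fun y _ => hrpos t (x, y)) Finset.univ_nonempty
  have h₂ : ∀ t y, 0 < ∑ x, r t (x, y) := fun t y =>
    Finset.sum_pos (fun x _ => hrpos t (x, y)) Finset.univ_nonempty
  refine ⟨fun t z => mul_pos (h₁ t z.1) (h₂ t z.2), fun t => ?_, fun t x y => ?_⟩
  · simp only [Fintype.sum_prod_type]
    rw [← Fintype.sum_mul_sum, ← Fintype.sum_prod_type,
      ← Fintype.sum_prod_type_right, hrsum, one_mul]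
  · have hlog : (fun s => Real.log ((∑ y', r s (x, y')) * ∑ x', r s (x', y))) =
        fun s => Real.log (∑ y', r s (x, y')) + Real.log (∑ x', r s (x', y)) :=
      funext fun s => Real.log_mul (h₁ s x).ne' (h₂ s y).ne'
    rw [hlog]
    exact (hasDerivAt_log_sum (f := fun s y' => r s (x, y')) (fun y' => hrpos t (x, y'))
      fun y' => hrd (x, y') t).fun_add
      (hasDerivAt_log_sum (f := fun s x' => r s (x', y)) (fun x' => hrpos t (x', y))
        fun x' => hrd (x', y) t)
end

section
/- Natural gradient of the divergence of the mean-field approximation from the joint distribution: let Ω = Ω₁ × Ω₂ with Ω₁, Ω₂ finite nonempty, and let t ↦ r(t) be a curve of positive probability functions on Ω with r(t)(x,y) differentiable in t for every (x,y). Write r = r(t), ṙ = ṙ(t), and r₁ ⊗ r₂ for the product of the margins of r. Then for every t, (d/dt) KL(r₁(t) ⊗ r₂(t) ‖ r(t)) = ⟨G, ṙ⟩_r, where G(x,y) = E_{r₁⊗r₂}[s_r(r₁⊗r₂) | Π₁ = x] + E_{r₁⊗r₂}[s_r(r₁⊗r₂) | Π₂ = y] − η_r(r₁⊗r₂)(x,y),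 with E_{r₁⊗r₂}[f | Π₁ = x] = ∑_y f(x,y) r₂(y) and E_{r₁⊗r₂}[f | Π₂ = y] = ∑_x f(x,y) r₁(x). -/
/-- The derivative of one summand of the divergence of a product from a third factor. -/
lemma hasDerivAt_log_mul_div_mul {a b p : ℝ → ℝ} {a' b' p' t : ℝ}
    (ha : HasDerivAt a a' t) (hb : HasDerivAt b b' t) (hp : HasDerivAt p p' t)
    (ha0 : a t ≠ 0) (hb0 : b t ≠ 0) (hp0 : p t ≠ 0) :
    HasDerivAt (fun u => Real.log (a u * b u / p u) * (a u * b u))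
      ((Real.log (a t * b t / p t) + 1) * (a' * b t + a t * b')
        - a t * b t / p t * p') t := by
  have hab := ha.fun_mul hb
  refine (((hab.fun_div hp hp0).log (div_ne_zero (mul_ne_zero ha0 hb0) hp0)).fun_mul
    hab).congr_deriv ?_
  field_simp
  ring

lemma sum_partial_fst_mul {α β : Type*} [Fintype α] [Fintype β]
    (f d : α × β → ℝ) (b : β → ℝ) :
    ∑ z : α × β, (∑ y, f (z.1, y) * b y) * d z
      = ∑ z : α × β, f z * ((∑ y, d (z.1, y)) * b z.2) := by
  simp only [Fintype.sum_prod_type]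
  refine Finset.sum_congr rfl fun x _ => ?_
  rw [← Finset.mul_sum, Finset.sum_mul]
  exact Finset.sum_congr rfl fun y _ => by ring

lemma sum_partial_snd_mul {α β : Type*} [Fintype α] [Fintype β]
    (f d : α × β → ℝ) (a : α → ℝ) :
    ∑ z : α × β, (∑ x, f (x, z.2) * a x) * d z
      = ∑ z : α × β, f z * (a z.1 * ∑ x, d (x, z.2)) := by
  simp only [Fintype.sum_prod_type_right]
  refine Finset.sum_congr rfl fun y _ => ?_
  rw [← Finset.mul_sum, Finset.sum_mul]
  exact Finset.sum_congr rfl fun x _ => by ring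

/-- Natural gradient of the divergence of the mean-field
approximation from the joint distribution. For a curve `t ↦ r t` of positive
probability functions on `Ω₁ × Ω₂` with margins `r₁`, `r₂`,
`(d/dt) KL(r₁(t) ⊗ r₂(t) ‖ r(t)) = ⟨G, ṙ⟩_r`, where
`G(x,y) = E_{r₁⊗r₂}[s_r(r₁⊗r₂) | Π₁ = x] + E_{r₁⊗r₂}[s_r(r₁⊗r₂) | Π₂ = y]
  − η_r(r₁⊗r₂)(x,y)`,
with `s_r(p) = log(p/r) − E_r[log(p/r)]`, `η_r(p) = p/r − 1`,
`E_{r₁⊗r₂}[f | Π₁ = x] = ∑ y, f(x,y) r₂(y)`,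
`E_{r₁⊗r₂}[f | Π₂ = y] = ∑ x, f(x,y) r₁(x)`,
and `⟨v,w⟩_r = ∑ z, v z * w z * r z`. -/
theorem mean_field_kl_gradient_first
    {Ω₁ Ω₂ : Type*} [Fintype Ω₁] [Nonempty Ω₁] [Fintype Ω₂] [Nonempty Ω₂]
    (r : ℝ → Ω₁ × Ω₂ → ℝ)
    (hrpos : ∀ t z, 0 < r t z) (hrsum : ∀ t, ∑ z, r t z = 1)
    (hrd : ∀ z, Differentiable ℝ fun t => r t z)
    (r₁ : ℝ → Ω₁ → ℝ) (hr₁ : r₁ = fun t x => ∑ y, r t (x, y))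
    (r₂ : ℝ → Ω₂ → ℝ) (hr₂ : r₂ = fun t y => ∑ x, r t (x, y))
    (t : ℝ)
    (s : Ω₁ × Ω₂ → ℝ)
    (hs : s = fun z => Real.log (r₁ t z.1 * r₂ t z.2 / r t z)
      - ∑ w : Ω₁ × Ω₂, Real.log (r₁ t w.1 * r₂ t w.2 / r t w) * r t w)
    (G : Ω₁ × Ω₂ → ℝ)
    (hG : G = fun z => (∑ y, s (z.1, y) * r₂ t y) + (∑ x, s (x, z.2) * r₁ t x)
      - (r₁ t z.1 * r₂ t z.2 / r t z - 1)) :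
    HasDerivAt (fun u => ∑ z : Ω₁ × Ω₂,
        Real.log (r₁ u z.1 * r₂ u z.2 / r u z) * (r₁ u z.1 * r₂ u z.2))
      (∑ z : Ω₁ × Ω₂, G z * deriv (fun u => Real.log (r u z)) t * r t z) t := by
  have hd (z : Ω₁ × Ω₂) : HasDerivAt (fun u => r u z) (deriv (fun u => r u z) t) t :=
    (hrd z t).hasDerivAt
  let d : Ω₁ × Ω₂ → ℝ := fun z => deriv (fun u => r u z) t
  have hd_sum : ∑ z, d z = 0 := by
    have h := HasDerivAt.fun_sum (u := Finset.univ) fun z _ => hd z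
    simp only [hrsum] at h
    exact h.unique (hasDerivAt_const t 1)
  have hd₁ (x : Ω₁) : HasDerivAt (fun u => r₁ u x) (∑ y, d (x, y)) t := by
    rw [hr₁]
    exact HasDerivAt.fun_sum fun y _ => hd (x, y)
  have hd₂ (y : Ω₂) : HasDerivAt (fun u => r₂ u y) (∑ x, d (x, y)) t := by
    rw [hr₂]
    exact HasDerivAt.fun_sum fun x _ => hd (x, y)
  have hpos₁ (x : Ω₁) : 0 < r₁ t x := by
    rw [hr₁]
    exact Finset.sum_pos (fun y _ => hrpos t (x, y)) Finset.univ_nonempty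
  have hpos₂ (y : Ω₂) : 0 < r₂ t y := by
    rw [hr₂]
    exact Finset.sum_pos (fun x _ => hrpos t (x, y)) Finset.univ_nonempty
  have hsum₁ : ∑ x, r₁ t x = 1 := by
    rw [hr₁, ← hrsum t, Fintype.sum_prod_type]
  have hsum₂ : ∑ y, r₂ t y = 1 := by
    rw [hr₂, ← hrsum t, Fintype.sum_prod_type_right]
  have hvel (z : Ω₁ × Ω₂) : G z * deriv (fun u => Real.log (r u z)) t * r t z = G z * d z := by
    rw [((hd z).log (hrpos t z).ne').deriv, mul_assoc, div_mul_cancel₀ _ (hrpos t z).ne']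
  have hvar₁ : ∑ z : Ω₁ × Ω₂, (∑ y, d (z.1, y)) * r₂ t z.2 = 0 := by
    have h := sum_partial_fst_mul (fun _ => 1) d (r₂ t)
    simp only [one_mul, hsum₂, hd_sum] at h
    exact h.symm
  have hvar₂ : ∑ z : Ω₁ × Ω₂, r₁ t z.1 * ∑ x, d (x, z.2) = 0 := by
    have h := sum_partial_snd_mul (fun _ => 1) d (r₁ t)
    simp only [one_mul, hsum₁, hd_sum] at h
    exact h.symm
  refine (HasDerivAt.fun_sum (u := Finset.univ) fun (z : Ω₁ × Ω₂) _ =>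
    hasDerivAt_log_mul_div_mul (hd₁ z.1) (hd₂ z.2) (hd z)
      (hpos₁ z.1).ne' (hpos₂ z.2).ne' (hrpos t z).ne').congr_deriv ?_
  change ∑ z : Ω₁ × Ω₂, ((Real.log (r₁ t z.1 * r₂ t z.2 / r t z) + 1)
    * ((∑ y, d (z.1, y)) * r₂ t z.2 + r₁ t z.1 * ∑ x, d (x, z.2))
    - r₁ t z.1 * r₂ t z.2 / r t z * d z) = _
  simp only [hvel]
  generalize (∑ w : Ω₁ × Ω₂, Real.log (r₁ t w.1 * r₂ t w.2 / r t w) * r t w) = c at hs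
  have hlog (z : Ω₁ × Ω₂) : Real.log (r₁ t z.1 * r₂ t z.2 / r t z) = s z + c := by
    rw [hs]
    ring
  have hinner : ∑ z, G z * d z
      = ∑ z : Ω₁ × Ω₂, s z * ((∑ y, d (z.1, y)) * r₂ t z.2)
        + ∑ z : Ω₁ × Ω₂, s z * (r₁ t z.1 * ∑ x, d (x, z.2))
        - ∑ z : Ω₁ × Ω₂, r₁ t z.1 * r₂ t z.2 / r t z * d z := by
    rw [← sum_partial_fst_mul, ← sum_partial_snd_mul, hG]
    simp only [sub_mul, add_mul, one_mul, Finset.sum_sub_distrib, Finset.sum_add_distrib, hd_sum,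
      sub_zero]
  rw [hinner]
  simp only [hlog, add_mul, mul_add, one_mul, Finset.sum_sub_distrib, Finset.sum_add_distrib,
    ← Finset.mul_sum, hvar₁, hvar₂, mul_zero, add_zero]
end

section
/- Natural gradient of the divergence of the joint distribution from its mean-field approximation (mutual information): let Ω = Ω₁ × Ω₂ with Ω₁, Ω₂ finite nonempty, and let t ↦ r(t) be a curve of positive probability functions on Ω with r(t)(x,y) differentiable in t for every (x,y). Write r = r(t), ṙ = ṙ(t), and r₁ ⊗ r₂ for the product of the margins of r. Then for every t, (d/dt) KL(r(t) ‖ r₁(t) ⊗ r₂(t)) = ⟨−s_r(r₁⊗r₂) + E_r[η_r(r₁⊗r₂) | Π₁] + E_r[η_r(r₁⊗r₂) | Π₂], ṙ⟩_r, where E_r[v | Π₁] denotes the function (x,y) ↦ E_r[v | Π₁ = x] and similarly for Π₂. -/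
/-- The conditional expectation of `p ⊗ q / ρ - 1` given one coordinate vanishes when `p` is the
value at that coordinate of the margin of `ρ` and `q` sums to one. -/
theorem sum_mixture_mul_div_eq_zero {ι : Type*} [Fintype ι] {ρ q : ι → ℝ} {p : ℝ}
    (hρ : ∀ i, 0 < ρ i) (hp : 0 < p) (hsum : ∑ i, ρ i = p) (hq : ∑ i, q i = 1) :
    ∑ i, (p * q i / ρ i - 1) * ρ i / p = 0 := by
  have h (i : ι) : (p * q i / ρ i - 1) * ρ i / p = q i - ρ i / p := by
    have := (hρ i).ne'
    field_simp
  simp_rw [h]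
  rw [Finset.sum_sub_distrib, ← Finset.sum_div, hsum, hq, div_self hp.ne', sub_self]

/-- Natural gradient of the divergence of the joint
distribution from its mean-field approximation (mutual information).
For a curve `t ↦ r t` of positive probability functions on `Ω₁ × Ω₂` with
margins `r₁`, `r₂`,
`(d/dt) KL(r(t) ‖ r₁(t) ⊗ r₂(t))
  = ⟨−s_r(r₁⊗r₂) + E_r[η_r(r₁⊗r₂) | Π₁] + E_r[η_r(r₁⊗r₂) | Π₂], ṙ⟩_r`,
with `s_r(p) = log(p/r) − E_r[log(p/r)]`, `η_r(p) = p/r − 1`,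
`E_r[v | Π₁ = x] = ∑ y, v(x,y) r(x,y)/r₁(x)`,
`E_r[v | Π₂ = y] = ∑ x, v(x,y) r(x,y)/r₂(y)`,
and `⟨v,w⟩_r = ∑ z, v z * w z * r z`. -/
theorem mutual_information_natural_gradient
    {Ω₁ Ω₂ : Type*} [Fintype Ω₁] [Nonempty Ω₁] [Fintype Ω₂] [Nonempty Ω₂]
    (r : ℝ → Ω₁ × Ω₂ → ℝ)
    (hrpos : ∀ t z, 0 < r t z) (hrsum : ∀ t, ∑ z, r t z = 1)
    (hrd : ∀ z, Differentiable ℝ fun t => r t z)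
    (r₁ : ℝ → Ω₁ → ℝ) (hr₁ : r₁ = fun t x => ∑ y, r t (x, y))
    (r₂ : ℝ → Ω₂ → ℝ) (hr₂ : r₂ = fun t y => ∑ x, r t (x, y))
    (t : ℝ)
    (s : Ω₁ × Ω₂ → ℝ)
    (hs : s = fun z => Real.log (r₁ t z.1 * r₂ t z.2 / r t z)
      - ∑ w : Ω₁ × Ω₂, Real.log (r₁ t w.1 * r₂ t w.2 / r t w) * r t w)
    (η : Ω₁ × Ω₂ → ℝ)
    (hη : η = fun z => r₁ t z.1 * r₂ t z.2 / r t z - 1)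
    (G : Ω₁ × Ω₂ → ℝ)
    (hG : G = fun z => -s z + (∑ y, η (z.1, y) * r t (z.1, y) / r₁ t z.1)
      + ∑ x, η (x, z.2) * r t (x, z.2) / r₂ t z.2) :
    HasDerivAt (fun u => ∑ z : Ω₁ × Ω₂,
        Real.log (r u z / (r₁ u z.1 * r₂ u z.2)) * r u z)
      (∑ z : Ω₁ × Ω₂, G z * deriv (fun u => Real.log (r u z)) t * r t z) t := by
  have hp₁ (u : ℝ) (x : Ω₁) : 0 < r₁ u x := by
    rw [hr₁]
    exact Finset.sum_pos (fun y _ => hrpos u (x, y)) Finset.univ_nonempty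
  have hp₂ (u : ℝ) (y : Ω₂) : 0 < r₂ u y := by
    rw [hr₂]
    exact Finset.sum_pos (fun x _ => hrpos u (x, y)) Finset.univ_nonempty
  have hsum₁ : ∑ x, r₁ t x = 1 := by
    rw [← hrsum t, Fintype.sum_prod_type, hr₁]
  have hsum₂ : ∑ y, r₂ t y = 1 := by
    rw [← hrsum t, Fintype.sum_prod_type_right, hr₂]
  have hcond₁ (x : Ω₁) : ∑ y, η (x, y) * r t (x, y) / r₁ t x = 0 := by
    rw [hη]
    exact sum_mixture_mul_div_eq_zero (fun y => hrpos t (x, y)) (hp₁ t x) (by rw [hr₁]) hsum₂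
  have hcond₂ (y : Ω₂) : ∑ x, η (x, y) * r t (x, y) / r₂ t y = 0 := by
    simp_rw [hη, mul_comm (r₁ t _) (r₂ t y)]
    exact sum_mixture_mul_div_eq_zero (fun x => hrpos t (x, y)) (hp₂ t y) (by rw [hr₂]) hsum₁
  set D : Ω₁ × Ω₂ → ℝ := fun z => deriv (fun u => r u z) t
  have hd (z : Ω₁ × Ω₂) : HasDerivAt (fun u => r u z) (D z) t := (hrd z t).hasDerivAt
  have hd₁ (x : Ω₁) : HasDerivAt (fun u => r₁ u x) (∑ y, D (x, y)) t := by
    rw [hr₁]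
    exact HasDerivAt.fun_sum fun y _ => hd (x, y)
  have hd₂ (y : Ω₂) : HasDerivAt (fun u => r₂ u y) (∑ x, D (x, y)) t := by
    rw [hr₂]
    exact HasDerivAt.fun_sum fun x _ => hd (x, y)
  have hD0 : ∑ z, D z = 0 := by
    have h := HasDerivAt.fun_sum (u := Finset.univ) fun z _ => hd z
    simp_rw [hrsum] at h
    exact h.unique (hasDerivAt_const t 1)
  have hmean₁ : ∑ z : Ω₁ × Ω₂, (∑ y, D (z.1, y)) / r₁ t z.1 * r t z = 0 := by
    rw [← hD0, Fintype.sum_prod_type, Fintype.sum_prod_type]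
    refine Finset.sum_congr rfl fun x _ => ?_
    dsimp only
    rw [← Finset.mul_sum, show ∑ y, r t (x, y) = r₁ t x by rw [hr₁],
      div_mul_cancel₀ _ (hp₁ t x).ne']
  have hmean₂ : ∑ z : Ω₁ × Ω₂, (∑ x, D (x, z.2)) / r₂ t z.2 * r t z = 0 := by
    rw [← hD0, Fintype.sum_prod_type_right, Fintype.sum_prod_type_right]
    refine Finset.sum_congr rfl fun y _ => ?_
    dsimp only
    rw [← Finset.mul_sum, show ∑ x, r t (x, y) = r₂ t y by rw [hr₂],
      div_mul_cancel₀ _ (hp₂ t y).ne']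
  have hlog (u : ℝ) (z : Ω₁ × Ω₂) : Real.log (r u z / (r₁ u z.1 * r₂ u z.2))
      = Real.log (r u z) - (Real.log (r₁ u z.1) + Real.log (r₂ u z.2)) := by
    rw [Real.log_div (hrpos u z).ne' (mul_pos (hp₁ u _) (hp₂ u _)).ne',
      Real.log_mul (hp₁ u _).ne' (hp₂ u _).ne']
  have hterm (z : Ω₁ × Ω₂) := (((hd z).log (hrpos t z).ne').sub
    (((hd₁ z.1).log (hp₁ t z.1).ne').add ((hd₂ z.2).log (hp₂ t z.2).ne'))).mul (hd z)
  simp_rw [hlog]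
  refine (HasDerivAt.fun_sum fun z _ => hterm z).congr_deriv ?_
  obtain ⟨c, hc⟩ : ∃ c, ∀ z, G z = Real.log (r t z)
      - (Real.log (r₁ t z.1) + Real.log (r₂ t z.2)) + c := by
    refine ⟨∑ w : Ω₁ × Ω₂, Real.log (r₁ t w.1 * r₂ t w.2 / r t w) * r t w, fun z => ?_⟩
    simp only [hG, hcond₁, hcond₂, hs]
    rw [← hlog, ← inv_div, Real.log_inv]
    ring
  have hright (z : Ω₁ × Ω₂) : G z * deriv (fun u => Real.log (r u z)) t * r t z
      = (Real.log (r t z) - (Real.log (r₁ t z.1) + Real.log (r₂ t z.2))) * D z + c * D z := by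
    rw [((hd z).log (hrpos t z).ne').deriv, hc, mul_assoc, div_mul_cancel₀ _ (hrpos t z).ne',
      add_mul]
  have hleft (z : Ω₁ × Ω₂) (a b l : ℝ) :
      (D z / r t z - (a + b)) * r t z + l * D z = D z - a * r t z - b * r t z + l * D z := by
    have := (hrpos t z).ne'
    field_simp
    ring
  simp_rw [hright]
  simp only [Pi.sub_apply, Pi.add_apply, hleft]
  simp only [Finset.sum_add_distrib, Finset.sum_sub_distrib, hmean₁, hmean₂,
    ← Finset.mul_sum, hD0]
  ring
end

section
/- Derivative of the variational lower bound: let Ω₁, Ω₂ be finite nonempty sets, q a positive probability function on Ω₁ × Ω₂, x ∈ Ω₁, and t ↦ r(t) a curve of positive probability functions on Ω₂ with r(t)(y) differentiable in t for every y. With L(r;x) = −KL(r ‖ q₂) + E_r[log q_{1|2}(x|·)], for every t one has (d/dt) L(r(t);x) = ⟨ṙ(t), log(q(x,·)/r(t)) − E_{r(t)}[log(q(x,·)/r(t))]⟩_{r(t)}. -/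
/-- Derivative of the variational lower bound.
For a positive probability function `q` on `Ω₁ × Ω₂` with margin
`q₂(y) = ∑ x, q(x,y)` and conditional `q_{1|2}(x|y) = q(x,y)/q₂(y)`, a point
`x`, and a curve `t ↦ r t` of positive probability functions on `Ω₂` with
coordinates differentiable in `t`, the lower bound
`L(r;x) = −KL(r ‖ q₂) + E_r[log q_{1|2}(x|·)]` satisfies
`(d/dt) L(r(t);x)
  = ⟨ṙ(t), log(q(x,·)/r(t)) − E_{r(t)}[log(q(x,·)/r(t))]⟩_{r(t)}`,
where `ṙ(t)(y) = (d/dt) log r(t)(y)`. -/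
theorem variational_lower_bound_derivative
    {Ω₁ Ω₂ : Type*} [Fintype Ω₁] [Nonempty Ω₁] [Fintype Ω₂] [Nonempty Ω₂]
    (q : Ω₁ × Ω₂ → ℝ)
    (hqpos : ∀ z, 0 < q z) (hqsum : ∑ z, q z = 1)
    (q₂ : Ω₂ → ℝ) (hq₂ : q₂ = fun y => ∑ x, q (x, y))
    (x : Ω₁)
    (r : ℝ → Ω₂ → ℝ)
    (hrpos : ∀ t y, 0 < r t y) (hrsum : ∀ t, ∑ y, r t y = 1)
    (hrd : ∀ y, Differentiable ℝ fun t => r t y)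
    (t : ℝ) :
    HasDerivAt (fun s =>
        -(∑ y, Real.log (r s y / q₂ y) * r s y)
          + ∑ y, Real.log (q (x, y) / q₂ y) * r s y)
      (∑ y, deriv (fun s => Real.log (r s y)) t *
          (Real.log (q (x, y) / r t y)
            - ∑ y', Real.log (q (x, y') / r t y') * r t y') * r t y) t := by
  have hq₂pos : ∀ y, 0 < q₂ y := fun y => by
    rw [hq₂]
    exact Finset.sum_pos (fun x' _ => hqpos (x', y)) Finset.univ_nonempty
  have hr : ∀ y, HasDerivAt (fun s => r s y) (deriv (fun s => r s y) t) t :=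
    fun y => (hrd y t).hasDerivAt
  have hsum : ∑ y, deriv (fun s => r s y) t = 0 := by
    refine (HasDerivAt.fun_sum fun y _ => hr y).unique ?_
    simpa only [hrsum] using hasDerivAt_const t (1 : ℝ)
  have hbound : (fun s => -(∑ y, Real.log (r s y / q₂ y) * r s y)
      + ∑ y, Real.log (q (x, y) / q₂ y) * r s y)
      = fun s => ∑ y, (Real.log (q (x, y)) - Real.log (r s y)) * r s y := by
    funext s
    rw [← Finset.sum_neg_distrib, ← Finset.sum_add_distrib]
    refine Finset.sum_congr rfl fun y _ => ?_
    rw [Real.log_div (hrpos s y).ne' (hq₂pos y).ne',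
      Real.log_div (hqpos (x, y)).ne' (hq₂pos y).ne']
    ring
  rw [hbound]
  refine (HasDerivAt.fun_sum fun y _ =>
    (((hr y).log (hrpos t y).ne').const_sub (Real.log (q (x, y)))).mul (hr y)).congr_deriv ?_
  set c := ∑ y', Real.log (q (x, y') / r t y') * r t y'
  have hterm : ∀ y, deriv (fun s => Real.log (r s y)) t *
      (Real.log (q (x, y) / r t y) - c) * r t y
      = (-(deriv (fun s => r s y) t / r t y) * r t y
          + (Real.log (q (x, y)) - Real.log (r t y)) * deriv (fun s => r s y) t)
        + (1 - c) * deriv (fun s => r s y) t := fun y => by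
    have hne := (hrpos t y).ne'
    rw [((hr y).log hne).deriv, Real.log_div (hqpos (x, y)).ne' hne]
    field_simp
    ring
  simp only [hterm, Finset.sum_add_distrib, ← Finset.mul_sum, hsum, mul_zero, add_zero]
end

section
/- Gradient flow derivative for variational Bayes in an exponential model: let Ω₁, Ω₂ be finite nonempty sets, q a positive probability function on Ω₁ × Ω₂ with margin q₂ and conditional q_{1|2}(x|y) = q(x,y)/q₂(y), and x ∈ Ω₁. Let u : Ω₂ → ℝ^d with E_{q₂}[uᵢ] = 0 for each i, ψ(θ) = log E_{q₂}[exp(θ·u)], and r_θ(y) = exp(θ·u(y) − ψ(θ)) q₂(y). Let t ↦ θ(t) ∈ ℝ^d be differentiable and L(r;x) = −KL(r ‖ q₂) + E_r[log q_{1|2}(x|·)]. Then (d/dt) L(r_{θ(t)};x) = ∑_{i=1}^d θ̇ᵢ(t) ( Cov_{r_{θ(t)}}(uᵢ, log q_{1|2}(x|·)) − ∑_{j=1}^d θⱼ(t) Cov_{r_{θ(t)}}(uᵢ, uⱼ) ). -/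
/-- The covariance of `v` and `w` under the weights `r` on a finite type. -/
def weightedCov {Ω : Type*} [Fintype Ω] (r v w : Ω → ℝ) : ℝ :=
  (∑ y, v y * w y * r y) - (∑ y, v y * r y) * (∑ y, w y * r y)

lemma weightedCov_comm {Ω : Type*} [Fintype Ω] (r v w : Ω → ℝ) :
    weightedCov r v w = weightedCov r w v := by
  simp only [weightedCov, mul_comm (v _) (w _), mul_comm (∑ y, v y * r y)]

lemma weightedCov_sub_right {Ω : Type*} [Fintype Ω] (r v w w' : Ω → ℝ) :
    weightedCov r v (fun y => w y - w' y) = weightedCov r v w - weightedCov r v w' := by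
  simp only [weightedCov, mul_sub, sub_mul, Finset.sum_sub_distrib]
  ring

lemma weightedCov_sum_left {Ω ι : Type*} [Fintype Ω] [Fintype ι] (r w : Ω → ℝ)
    (c : ι → ℝ) (v : Ω → ι → ℝ) :
    weightedCov r (fun y => ∑ i, c i * v y i) w =
      ∑ i, c i * weightedCov r (fun y => v y i) w := by
  have hsum : ∀ g : Ω → ℝ, ∑ y, (∑ i, c i * v y i) * g y = ∑ i, c i * ∑ y, v y i * g y :=
    fun g => by
      simp only [Finset.sum_mul, Finset.mul_sum, mul_assoc]
      exact Finset.sum_comm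
  have hmul : ∀ f : Ω → ℝ, ∑ y, f y * w y * r y = ∑ y, f y * (w y * r y) :=
    fun f => Finset.sum_congr rfl fun y _ => mul_assoc _ _ _
  simp only [weightedCov, hmul]
  rw [hsum r, hsum fun y => w y * r y, Finset.sum_mul, ← Finset.sum_sub_distrib]
  exact Finset.sum_congr rfl fun i _ => by ring

lemma weightedCov_sum_right {Ω ι : Type*} [Fintype Ω] [Fintype ι] (r v : Ω → ℝ)
    (c : ι → ℝ) (w : Ω → ι → ℝ) :
    weightedCov r v (fun y => ∑ i, c i * w y i) =
      ∑ i, c i * weightedCov r v (fun y => w y i) := by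
  simp only [weightedCov_comm r v, weightedCov_sum_left]

/-- Derivative of the evidence lower bound `-KL(r ‖ p) + E_r[l]` along a curve of Gibbs
tiltings `r` of `p` with potentials `a s`. -/
lemma hasDerivAt_neg_klDiv_add_expectation {Ω : Type*} [Fintype Ω] [Nonempty Ω]
    (p : Ω → ℝ) (hp : ∀ y, 0 < p y) (l : Ω → ℝ) (a : ℝ → Ω → ℝ) (a' : Ω → ℝ) (t : ℝ)
    (ha : ∀ y, HasDerivAt (fun s => a s y) (a' y) t)
    (r : ℝ → Ω → ℝ)
    (hr : ∀ s y, r s y = Real.exp (a s y - Real.log (∑ z, Real.exp (a s z) * p z)) * p y) :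
    HasDerivAt (fun s => -(∑ y, Real.log (r s y / p y) * r s y) + ∑ y, l y * r s y)
      (weightedCov (r t) a' (fun y => l y - a t y)) t := by
  set Z : ℝ → ℝ := fun s => ∑ z, Real.exp (a s z) * p z with hZ
  have hZpos : ∀ s, 0 < Z s := fun s =>
    Finset.sum_pos (fun z _ => mul_pos (Real.exp_pos _) (hp z)) Finset.univ_nonempty
  have hr_div : ∀ s y, r s y = Real.exp (a s y) * p y / Z s := fun s y => by
    rw [hr, Real.exp_sub, Real.exp_log (hZpos s)]
    ring
  have hsum : ∀ s, ∑ y, r s y = 1 := fun s => by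
    simp only [hr_div, ← Finset.sum_div]
    exact div_self (hZpos s).ne'
  have hlog : ∀ s y, Real.log (r s y / p y) = a s y - Real.log (Z s) := fun s y => by
    rw [hr, mul_div_cancel_right₀ _ (hp y).ne', Real.log_exp]
  have hlogZ : HasDerivAt (fun s => Real.log (Z s)) (∑ y, a' y * r t y) t := by
    have h : HasDerivAt Z (∑ y, Real.exp (a t y) * a' y * p y) t :=
      HasDerivAt.fun_sum fun y _ => (ha y).exp.mul_const (p y)
    convert h.log (hZpos t).ne' using 1
    rw [Finset.sum_div]
    exact Finset.sum_congr rfl fun y _ => by rw [hr_div]; ring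
  have hr' : ∀ y, HasDerivAt (fun s => r s y) ((a' y - ∑ z, a' z * r t z) * r t y) t := fun y => by
    rw [show (fun s => r s y) = fun s => Real.exp (a s y - Real.log (Z s)) * p y from
      funext fun s => hr s y]
    refine (((ha y).fun_sub hlogZ).exp.mul_const (p y)).congr_deriv ?_
    rw [hr t y]
    ring
  have hL : (fun s => -(∑ y, Real.log (r s y / p y) * r s y) + ∑ y, l y * r s y) =
      fun s => (∑ y, (l y - a s y) * r s y) + Real.log (Z s) := funext fun s => by
    simp only [hlog, sub_mul, Finset.sum_sub_distrib, ← Finset.mul_sum, hsum]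
    ring
  rw [hL]
  refine ((HasDerivAt.fun_sum (u := Finset.univ) fun y _ =>
    ((ha y).const_sub (l y)).fun_mul (hr' y)).fun_add hlogZ).congr_deriv ?_
  set m := ∑ z, a' z * r t z with hm
  have hterm : ∀ y, -a' y * r t y + (l y - a t y) * ((a' y - m) * r t y) =
      a' y * (l y - a t y) * r t y - m * ((l y - a t y) * r t y) - a' y * r t y :=
    fun y => by ring
  simp only [hterm, Finset.sum_sub_distrib, ← Finset.mul_sum, weightedCov, ← hm]
  ring

/-- Gradient flow derivative for variational Bayes in an
exponential model. With `q` a positive probability function on `Ω₁ × Ω₂`,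
margin `q₂(y) = ∑ x, q(x,y)`, conditional `q_{1|2}(x|y) = q(x,y)/q₂(y)`,
`u : Ω₂ → ℝ^d` with `E_{q₂}[uᵢ] = 0`, `ψ(θ) = log E_{q₂}[exp(θ·u)]`,
`r_θ(y) = exp(θ·u(y) − ψ(θ)) q₂(y)`, a differentiable curve `t ↦ θ(t)`, and
`L(r;x) = −KL(r ‖ q₂) + E_r[log q_{1|2}(x|·)]`, one has
`(d/dt) L(r_{θ(t)};x) = ∑ i, θ̇ᵢ(t) (Cov_{r_{θ(t)}}(uᵢ, log q_{1|2}(x|·))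
  − ∑ j, θⱼ(t) Cov_{r_{θ(t)}}(uᵢ, uⱼ))`,
where `Cov_r(v,w) = E_r[v·w] − E_r[v]·E_r[w]`. -/
theorem variational_bayes_gradient_flow_derivative
    {Ω₁ Ω₂ : Type*} [Fintype Ω₁] [Nonempty Ω₁] [Fintype Ω₂] [Nonempty Ω₂]
    {d : ℕ}
    (q : Ω₁ × Ω₂ → ℝ)
    (hqpos : ∀ z, 0 < q z) (hqsum : ∑ z, q z = 1)
    (q₂ : Ω₂ → ℝ) (hq₂ : q₂ = fun y => ∑ x, q (x, y))
    (x : Ω₁)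
    (u : Ω₂ → Fin d → ℝ) (hu : ∀ i, ∑ y, u y i * q₂ y = 0)
    (ψ : (Fin d → ℝ) → ℝ)
    (hψ : ψ = fun θ => Real.log (∑ y, Real.exp (∑ i, θ i * u y i) * q₂ y))
    (rθ : (Fin d → ℝ) → Ω₂ → ℝ)
    (hrθ : rθ = fun θ y => Real.exp ((∑ i, θ i * u y i) - ψ θ) * q₂ y)
    (Cov : (Fin d → ℝ) → (Ω₂ → ℝ) → (Ω₂ → ℝ) → ℝ)
    (hCov : Cov = fun θ v w =>
      (∑ y, v y * w y * rθ θ y) - (∑ y, v y * rθ θ y) * (∑ y, w y * rθ θ y))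
    (θ : ℝ → Fin d → ℝ)
    (hθd : ∀ i, Differentiable ℝ fun s => θ s i)
    (t : ℝ) :
    HasDerivAt (fun s =>
        -(∑ y, Real.log (rθ (θ s) y / q₂ y) * rθ (θ s) y)
          + ∑ y, Real.log (q (x, y) / q₂ y) * rθ (θ s) y)
      (∑ i, deriv (fun s => θ s i) t *
          (Cov (θ t) (fun y => u y i) (fun y => Real.log (q (x, y) / q₂ y))
            - ∑ j, θ t j * Cov (θ t) (fun y => u y i) (fun y => u y j))) t := by
  have hq₂pos : ∀ y, 0 < q₂ y := fun y => by
    rw [hq₂]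
    exact Finset.sum_pos (fun z _ => hqpos (z, y)) Finset.univ_nonempty
  have hCov' : ∀ v w, Cov (θ t) v w = weightedCov (rθ (θ t)) v w := fun v w => by
    rw [hCov, weightedCov]
  refine (hasDerivAt_neg_klDiv_add_expectation q₂ hq₂pos (fun y => Real.log (q (x, y) / q₂ y))
    (fun s y => ∑ i, θ s i * u y i) (fun y => ∑ i, deriv (fun s => θ s i) t * u y i) t
    (fun y => HasDerivAt.fun_sum fun i _ => (hθd i t).hasDerivAt.mul_const (u y i))
    (fun s => rθ (θ s)) (fun s y => by rw [hrθ, hψ])).congr_deriv ?_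
  rw [weightedCov_sum_left]
  simp only [weightedCov_sub_right, weightedCov_sum_right, hCov']
end

section
/- Integral representation of the KL-divergence by variances along the exponential arc: let q and r be positive probability functions on a finite nonempty set Ω. For s, t ∈ [0,1] define the positive probability function q(s,t)(x) = q(x)^{1−st} r(x)^{st} / Z(st), where Z(u) = ∑_x q(x)^{1−u} r(x)^{u}. Then KL(q ‖ r) = ∫₀¹ ∫₀¹ Var_{q(s,t)}(log(r/q)) · s ds dt. -/
/-- The `k`-th moment of `L` under the unnormalised exponential family
`x ↦ a x * exp (u * L x)`. -/
noncomputable def expMoment {Ω : Type*} [Fintype Ω] (a L : Ω → ℝ) (k : ℕ) (u : ℝ) : ℝ :=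
  ∑ x, L x ^ k * (a x * Real.exp (u * L x))

/-- The variance of `L` under the normalised exponential family. -/
noncomputable def expVariance {Ω : Type*} [Fintype Ω] (a L : Ω → ℝ) (u : ℝ) : ℝ :=
  expMoment a L 2 u / expMoment a L 0 u - (expMoment a L 1 u / expMoment a L 0 u) ^ 2

section ExponentialFamily

variable {Ω : Type*} [Fintype Ω] (a L : Ω → ℝ)

theorem hasDerivAt_expMoment (k : ℕ) (u : ℝ) :
    HasDerivAt (expMoment a L k) (expMoment a L (k + 1) u) u := by
  unfold expMoment
  refine HasDerivAt.fun_sum fun x _ => ?_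
  have h := ((((hasDerivAt_id u).mul_const (L x)).exp).const_mul (a x)).const_mul (L x ^ k)
  refine h.congr_deriv ?_
  simp only [id]
  ring

theorem continuous_expMoment (k : ℕ) : Continuous (expMoment a L k) :=
  continuous_iff_continuousAt.2 fun u => (hasDerivAt_expMoment a L k u).continuousAt

variable {a}

theorem expMoment_zero_pos [Nonempty Ω] (ha : ∀ x, 0 < a x) (u : ℝ) : 0 < expMoment a L 0 u :=
  Finset.sum_pos (fun x _ => by have := ha x; positivity) Finset.univ_nonempty

theorem continuous_expVariance [Nonempty Ω] (ha : ∀ x, 0 < a x) :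
    Continuous (expVariance a L) := by
  have h0 : ∀ u, expMoment a L 0 u ≠ 0 := fun u => (expMoment_zero_pos L ha u).ne'
  exact ((continuous_expMoment a L 2).div (continuous_expMoment a L 0) h0).sub
    (((continuous_expMoment a L 1).div (continuous_expMoment a L 0) h0).pow 2)

theorem hasDerivAt_log_expMoment_zero [Nonempty Ω] (ha : ∀ x, 0 < a x) (u : ℝ) :
    HasDerivAt (fun u => Real.log (expMoment a L 0 u))
      (expMoment a L 1 u / expMoment a L 0 u) u :=
  (hasDerivAt_expMoment a L 0 u).log (expMoment_zero_pos L ha u).ne'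

theorem hasDerivAt_expMean [Nonempty Ω] (ha : ∀ x, 0 < a x) (u : ℝ) :
    HasDerivAt (fun u => expMoment a L 1 u / expMoment a L 0 u) (expVariance a L u) u := by
  have h0 := (expMoment_zero_pos L ha u).ne'
  refine ((hasDerivAt_expMoment a L 1 u).div (hasDerivAt_expMoment a L 0 u) h0).congr_deriv ?_
  unfold expVariance
  field_simp

/-- Second-order Taylor formula for the log-partition function on `[0, 1]`. -/
theorem integral_integral_expVariance [Nonempty Ω] (ha : ∀ x, 0 < a x) :
    ∫ t in (0 : ℝ)..1, ∫ s in (0 : ℝ)..1, expVariance a L (s * t) * s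
      = Real.log (expMoment a L 0 1) - Real.log (expMoment a L 0 0)
        - expMoment a L 1 0 / expMoment a L 0 0 := by
  have hc := continuous_expVariance L ha
  have hmean : Continuous fun u => expMoment a L 1 u / expMoment a L 0 u :=
    (continuous_expMoment a L 1).div (continuous_expMoment a L 0)
      fun u => (expMoment_zero_pos L ha u).ne'
  have hswap : ∫ t in (0 : ℝ)..1, ∫ s in (0 : ℝ)..1, expVariance a L (s * t) * s
      = ∫ s in (0 : ℝ)..1, ∫ t in (0 : ℝ)..1, expVariance a L (s * t) * s := by
    refine MeasureTheory.intervalIntegral_intervalIntegral_swap ?_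
    have hF : Continuous (Function.uncurry fun t s : ℝ => expVariance a L (s * t) * s) := by
      unfold Function.uncurry
      fun_prop
    exact (hF.continuousOn.integrableOn_compact (isCompact_uIcc.prod isCompact_uIcc)).mono_set
      (Set.prod_mono Set.uIoc_subset_uIcc Set.uIoc_subset_uIcc)
  have hinner (s : ℝ) : ∫ t in (0 : ℝ)..1, expVariance a L (s * t) * s
      = expMoment a L 1 s / expMoment a L 0 s - expMoment a L 1 0 / expMoment a L 0 0 := by
    rw [intervalIntegral.integral_eq_sub_of_hasDerivAt
      (f := fun t => expMoment a L 1 (s * t) / expMoment a L 0 (s * t))]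
    · simp
    · intro t _
      have h := (hasDerivAt_expMean L ha (s * t)).comp t ((hasDerivAt_id t).const_mul s)
      simpa [Function.comp_def] using h
    · exact Continuous.intervalIntegrable (by fun_prop) _ _
  rw [hswap, funext hinner, intervalIntegral.integral_sub
    (hmean.intervalIntegrable _ _) intervalIntegrable_const,
    intervalIntegral.integral_eq_sub_of_hasDerivAt
      (fun u _ => hasDerivAt_log_expMoment_zero L ha u) (hmean.intervalIntegrable _ _)]
  simp

end ExponentialFamily

theorem rpow_one_sub_mul_rpow {a b : ℝ} (ha : 0 < a) (hb : 0 < b) (u : ℝ) :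
    a ^ (1 - u) * b ^ u = a * Real.exp (u * Real.log (b / a)) := by
  rw [Real.rpow_def_of_pos ha, Real.rpow_def_of_pos hb, Real.log_div hb.ne' ha.ne']
  nth_rw 2 [← Real.exp_log ha]
  rw [← Real.exp_add, ← Real.exp_add]
  ring_nf


/-- Integral representation of the KL-divergence by variances
along the exponential arc. For positive probability functions `q`, `r` on a
finite nonempty `Ω`, with `q(s,t)(x) = q(x)^{1−st} r(x)^{st} / Z(st)`,
`Z(u) = ∑ x, q(x)^{1−u} r(x)^u`, and `Var_p(v) = E_p[v²] − (E_p[v])²`,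
`KL(q ‖ r) = ∫₀¹ ∫₀¹ Var_{q(s,t)}(log(r/q)) · s ds dt`. -/
theorem kl_integral_variance_representation
    {Ω : Type*} [Fintype Ω] [Nonempty Ω]
    (q r : Ω → ℝ)
    (hqpos : ∀ x, 0 < q x) (hqsum : ∑ x, q x = 1)
    (hrpos : ∀ x, 0 < r x) (hrsum : ∑ x, r x = 1)
    (Z : ℝ → ℝ) (hZ : Z = fun u => ∑ x, q x ^ ((1 : ℝ) - u) * r x ^ u)
    (Q : ℝ → ℝ → Ω → ℝ)
    (hQ : Q = fun s t x => q x ^ ((1 : ℝ) - s * t) * r x ^ (s * t) / Z (s * t))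
    (V : ℝ → ℝ → ℝ)
    (hV : V = fun s t =>
      (∑ x, Real.log (r x / q x) ^ 2 * Q s t x)
        - (∑ x, Real.log (r x / q x) * Q s t x) ^ 2) :
    ∑ x, Real.log (q x / r x) * q x
      = ∫ t in (0 : ℝ)..1, ∫ s in (0 : ℝ)..1, V s t * s := by
  set L : Ω → ℝ := fun x => Real.log (r x / q x) with hL
  have hpow (u : ℝ) (x : Ω) : q x ^ (1 - u) * r x ^ u = q x * Real.exp (u * L x) :=
    rpow_one_sub_mul_rpow (hqpos x) (hrpos x) u
  have hZ' : Z = expMoment q L 0 := by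
    funext u
    simp [hZ, hpow, expMoment]
  have hV' (s t : ℝ) : V s t = expVariance q L (s * t) := by
    simp only [hV, hQ, hpow, hZ', expVariance]
    simp only [← mul_div_assoc, ← Finset.sum_div]
    simp [expMoment, hL]
  have hZ0 : expMoment q L 0 0 = 1 := by simp [expMoment, hqsum]
  have hZ1 : expMoment q L 0 1 = 1 := by simp [← hZ', hZ, hrsum]
  simp only [hV', integral_integral_expVariance L hqpos, hZ0, hZ1]
  simp only [expMoment, hL, Real.log_one, div_one, sub_self, zero_sub, zero_mul, Real.exp_zero,
    mul_one, pow_one, ← Finset.sum_neg_distrib]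
  refine Finset.sum_congr rfl fun x _ => ?_
  rw [← inv_div, Real.log_inv, neg_mul]
end
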